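/- Let 1 ≤ p < q ≤ ∞, set α = 1/p − 1/q (with the convention 1/∞ = 0), and let m, n ∈ ℕ with 2 ≤ n ≤ m ≤ 2ⁿ. Let X, Y be Banach spaces, T₀ a bounded linear operator from X to Y, and let T(m) : ℓ_p^m(X) → ℓ_q^m(Y) be the diagonal operator T(m)(x₁, …, x_m) = (T₀(x₁), …, T₀(x_m)). Then c₁·A(n,m,T₀) ≤ e_n(T(m)) ≤ c₂·A(n,m,T₀), where c₁, c₂ are positive constants depending only on p and q, and A(n,m,T₀) = max( ‖T₀‖·((log₂(m/n) + 1)/n)^α , max_{k ∈ {1,…,n}} (k/n)^α·e_k(T₀) ). -/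

import Mathlib

open Metric Set
open scoped ENNReal

/-- The `n`-th (dyadic) entropy number of a bounded linear operator `T : X → Y`:
the infimum of all `ε > 0` such that the image of the closed unit ball of `X`
can be covered by `2 ^ (n - 1)` closed balls of radius `ε` in `Y`. -/
noncomputable def entropyNum {X Y : Type*} [NormedAddCommGroup X] [NormedSpace ℝ X]
    [NormedAddCommGroup Y] [NormedSpace ℝ Y] (n : ℕ) (T : X →L[ℝ] Y) : ℝ :=
  sInf {ε : ℝ | 0 < ε ∧ ∃ S : Finset Y, S.card ≤ 2 ^ (n - 1) ∧
    T '' closedBall 0 1 ⊆ ⋃ y ∈ S, closedBall y ε}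

/-- The `n`-th (dyadic) inner entropy number of a bounded linear operator `T : X → Y`:
the supremum of all `ε > 0` such that there are `2 ^ (n - 1) + 1` points in the closed
unit ball of `X` whose images under `T` are pairwise at distance at least `2 * ε`. -/
noncomputable def innerEntropyNum {X Y : Type*} [NormedAddCommGroup X] [NormedSpace ℝ X]
    [NormedAddCommGroup Y] [NormedSpace ℝ Y] (n : ℕ) (T : X →L[ℝ] Y) : ℝ :=
  sSup {ε : ℝ | 0 < ε ∧ ∃ x : Fin (2 ^ (n - 1) + 1) → X, (∀ i, ‖x i‖ ≤ 1) ∧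
    ∀ i j, i ≠ j → 2 * ε ≤ ‖T (x i) - T (x j)‖}

theorem bddBelow_entropyNum_radii {X Y : Type*} [NormedAddCommGroup X] [NormedSpace ℝ X]
    [NormedAddCommGroup Y] [NormedSpace ℝ Y] (n : ℕ) (T : X →L[ℝ] Y) :
    BddBelow {ε : ℝ | 0 < ε ∧ ∃ S : Finset Y, S.card ≤ 2 ^ (n - 1) ∧
      T '' closedBall 0 1 ⊆ ⋃ y ∈ S, closedBall y ε} :=
  ⟨0, fun _ h => h.1.le⟩

theorem mem_entropyNum_radii_of_opNorm_le {X Y : Type*} [NormedAddCommGroup X] [NormedSpace ℝ X]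
    [NormedAddCommGroup Y] [NormedSpace ℝ Y] (n : ℕ) (T : X →L[ℝ] Y) {ε : ℝ} (hε : 0 < ε)
    (hT : ‖T‖ ≤ ε) :
    ε ∈ {ε : ℝ | 0 < ε ∧ ∃ S : Finset Y, S.card ≤ 2 ^ (n - 1) ∧
      T '' closedBall 0 1 ⊆ ⋃ y ∈ S, closedBall y ε} := by
  refine ⟨hε, {0}, by simpa using Nat.one_le_two_pow, ?_⟩
  rintro _ ⟨x, hx, rfl⟩
  have hx' : ‖x‖ ≤ 1 := by simpa using hx
  have h := T.le_of_opNorm_le_of_le hT hx'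
  simpa using h

theorem entropyNum_nonneg {X Y : Type*} [NormedAddCommGroup X] [NormedSpace ℝ X]
    [NormedAddCommGroup Y] [NormedSpace ℝ Y] (n : ℕ) (T : X →L[ℝ] Y) : 0 ≤ entropyNum n T :=
  Real.sInf_nonneg fun _ h => h.1.le

theorem entropyNum_le_of_cover {X Y : Type*} [NormedAddCommGroup X] [NormedSpace ℝ X]
    [NormedAddCommGroup Y] [NormedSpace ℝ Y] {n : ℕ} {T : X →L[ℝ] Y} {ε : ℝ} (hε : 0 < ε)
    (S : Finset Y) (hS : S.card ≤ 2 ^ (n - 1))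
    (hcov : ∀ x, ‖x‖ ≤ 1 → ∃ y ∈ S, ‖T x - y‖ ≤ ε) : entropyNum n T ≤ ε := by
  refine csInf_le (bddBelow_entropyNum_radii n T) ⟨hε, S, hS, ?_⟩
  rintro _ ⟨x, hx, rfl⟩
  obtain ⟨y, hy, h⟩ := hcov x (by simpa using hx)
  simp only [mem_iUnion, mem_closedBall, dist_eq_norm]
  exact ⟨y, hy, h⟩

theorem entropyNum_le_opNorm {X Y : Type*} [NormedAddCommGroup X] [NormedSpace ℝ X]
    [NormedAddCommGroup Y] [NormedSpace ℝ Y] (n : ℕ) (T : X →L[ℝ] Y) : entropyNum n T ≤ ‖T‖ :=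
  le_of_forall_pos_le_add fun δ hδ => csInf_le (bddBelow_entropyNum_radii n T)
    (mem_entropyNum_radii_of_opNorm_le n T (by positivity) (by linarith))

/-- A radius exceeding the entropy number admits a cover. -/
theorem exists_cover_of_entropyNum_lt {X Y : Type*} [NormedAddCommGroup X] [NormedSpace ℝ X]
    [NormedAddCommGroup Y] [NormedSpace ℝ Y] {n : ℕ} {T : X →L[ℝ] Y} {r : ℝ}
    (h : entropyNum n T < r) :
    ∃ S : Finset Y, S.card ≤ 2 ^ (n - 1) ∧ ∀ x, ‖x‖ ≤ 1 → ∃ y ∈ S, ‖T x - y‖ ≤ r := by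
  obtain ⟨ε, ⟨-, S, hS, hcov⟩, hlt⟩ := exists_lt_of_csInf_lt
    ⟨_, mem_entropyNum_radii_of_opNorm_le n T (ε := ‖T‖ + 1) (by positivity) (by linarith)⟩ h
  refine ⟨S, hS, fun x hx => ?_⟩
  have := hcov ⟨x, by simpa using hx, rfl⟩
  simp only [mem_iUnion, mem_closedBall, dist_eq_norm] at this
  obtain ⟨y, hy, hd⟩ := this
  exact ⟨y, hy, hd.trans hlt.le⟩

/-- More than `2 ^ (n - 1)` points of the unit ball with `2 ε`-separated images bound the
entropy number from below by `ε`. -/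
theorem le_entropyNum_of_separated {X Y ι : Type*} [NormedAddCommGroup X] [NormedSpace ℝ X]
    [NormedAddCommGroup Y] [NormedSpace ℝ Y] {n : ℕ} {T : X →L[ℝ] Y} {ε : ℝ}
    (C : Finset ι) (hC : 2 ^ (n - 1) < C.card) (v : ι → X) (hv : ∀ i ∈ C, ‖v i‖ ≤ 1)
    (hsep : ∀ i ∈ C, ∀ j ∈ C, i ≠ j → 2 * ε ≤ ‖T (v i) - T (v j)‖) : ε ≤ entropyNum n T := by
  by_contra! hlt
  obtain ⟨r, hr, hrε⟩ := exists_between hlt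
  obtain ⟨S, hS, hcov⟩ := exists_cover_of_entropyNum_lt hr
  choose! f hfS hf using fun i (hi : i ∈ C) => hcov (v i) (hv i hi)
  obtain ⟨i, hi, j, hj, hij, hfij⟩ :=
    Finset.exists_ne_map_eq_of_card_lt_of_maps_to (hS.trans_lt hC) hfS
  have h1 := hf i hi
  have h2 := hf j hj
  rw [← hfij, norm_sub_rev] at h2
  have h3 := norm_sub_le_norm_sub_add_norm_sub (T (v i)) (f i) (T (v j))
  linarith [hsep i hi j hj hij]

/-- Below the entropy number there are more than `2 ^ (n - 1)` points with separated images. -/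
theorem exists_separated_of_lt_entropyNum {X Y : Type*} [NormedAddCommGroup X] [NormedSpace ℝ X]
    [NormedAddCommGroup Y] [NormedSpace ℝ Y] {n : ℕ} {T : X →L[ℝ] Y} {ε : ℝ} (hε : 0 < ε)
    (h : ε < entropyNum n T) :
    ∃ C : Finset X, C.card = 2 ^ (n - 1) ∧ (∀ x ∈ C, ‖x‖ ≤ 1) ∧
      ∀ x ∈ C, ∀ y ∈ C, x ≠ y → ε ≤ ‖T x - T y‖ := by
  classical
  suffices H : ∀ j ≤ 2 ^ (n - 1), ∃ C : Finset X, C.card = j ∧ (∀ x ∈ C, ‖x‖ ≤ 1) ∧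
      ∀ x ∈ C, ∀ y ∈ C, x ≠ y → ε ≤ ‖T x - T y‖ from H _ le_rfl
  intro j
  induction j with
  | zero => exact fun _ => ⟨∅, by simp⟩
  | succ j ih =>
    intro hj
    obtain ⟨C, hcard, hC, hsep⟩ := ih (by omega)
    obtain ⟨x, hx, hfar⟩ : ∃ x, ‖x‖ ≤ 1 ∧ ∀ y ∈ C, ε < ‖T x - T y‖ := by
      by_contra! hcon
      refine h.not_ge (entropyNum_le_of_cover hε (C.image T)
        (Finset.card_image_le.trans (by omega)) fun x hx => ?_)
      obtain ⟨y, hy, hd⟩ := hcon x hx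
      exact ⟨T y, Finset.mem_image_of_mem _ hy, hd⟩
    have hxC : x ∉ C := fun hmem => by
      have := hfar x hmem
      simp only [sub_self, norm_zero] at this
      linarith
    refine ⟨insert x C, by rw [Finset.card_insert_of_notMem hxC, hcard], ?_, ?_⟩
    · intro y hy
      rcases Finset.mem_insert.1 hy with rfl | hy
      exacts [hx, hC y hy]
    · intro y hy z hz hyz
      rcases Finset.mem_insert.1 hy with rfl | hyC <;>
        rcases Finset.mem_insert.1 hz with rfl | hzC
      · exact absurd rfl hyz
      · exact (hfar z hzC).le
      · rw [norm_sub_rev]; exact (hfar y hyC).le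
      · exact hsep y hyC z hzC hyz

theorem norm_piLp_le_of_forall_le {ι E : Type*} [Fintype ι] [NormedAddCommGroup E]
    {q : ℝ≥0∞} [Fact (1 ≤ q)] (y : PiLp q (fun _ : ι => E)) {B s : ℝ} {a : ι → ℝ}
    (hB : 0 ≤ B) (ha : ∀ i, 0 ≤ a i) (hs : ∑ i, a i ≤ s)
    (h : ∀ i, ‖y i‖ ≤ B * a i ^ (1 / q.toReal)) : ‖y‖ ≤ B * s ^ (1 / q.toReal) := by
  have hs0 : 0 ≤ s := (Finset.sum_nonneg fun i _ => ha i).trans hs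
  rcases eq_or_ne q ∞ with rfl | hq
  · simp only [ENNReal.toReal_top, div_zero, Real.rpow_zero, mul_one] at h ⊢
    rw [PiLp.norm_eq_ciSup]
    exact Real.iSup_le h hB
  · have hq0 : 0 < q.toReal :=
      ENNReal.toReal_pos (zero_lt_one.trans_le (Fact.out : 1 ≤ q)).ne' hq
    rw [PiLp.norm_eq_sum hq0]
    have hsum : ∑ i, ‖y i‖ ^ q.toReal ≤ B ^ q.toReal * s := by
      calc ∑ i, ‖y i‖ ^ q.toReal ≤ ∑ i, B ^ q.toReal * a i := by
            refine Finset.sum_le_sum fun i _ => ?_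
            refine (Real.rpow_le_rpow (norm_nonneg _) (h i) hq0.le).trans_eq ?_
            rw [Real.mul_rpow hB (Real.rpow_nonneg (ha i) _), ← Real.rpow_mul (ha i),
              one_div_mul_cancel hq0.ne', Real.rpow_one]
        _ ≤ _ := by rw [← Finset.mul_sum]; gcongr
    refine (Real.rpow_le_rpow (by positivity) hsum (by positivity)).trans_eq ?_
    rw [Real.mul_rpow (by positivity) hs0, ← Real.rpow_mul hB, mul_one_div_cancel hq0.ne',
      Real.rpow_one]

theorem card_rpow_mul_le_norm_piLp {ι E : Type*} [Fintype ι] [NormedAddCommGroup E]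
    {q : ℝ≥0∞} [Fact (1 ≤ q)] (y : PiLp q (fun _ : ι => E)) {ε : ℝ} (hε : 0 ≤ ε)
    (S : Finset ι) (hS : S.Nonempty) (h : ∀ i ∈ S, ε ≤ ‖y i‖) :
    (S.card : ℝ) ^ (1 / q.toReal) * ε ≤ ‖y‖ := by
  rcases eq_or_ne q ∞ with rfl | hq
  · obtain ⟨i, hi⟩ := hS
    simpa using (h i hi).trans (PiLp.norm_apply_le y i)
  · have hq0 : 0 < q.toReal :=
      ENNReal.toReal_pos (zero_lt_one.trans_le (Fact.out : 1 ≤ q)).ne' hq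
    rw [PiLp.norm_eq_sum hq0]
    have hsum : (S.card : ℝ) * ε ^ q.toReal ≤ ∑ i, ‖y i‖ ^ q.toReal := by
      calc (S.card : ℝ) * ε ^ q.toReal = ∑ i ∈ S, ε ^ q.toReal := by simp
        _ ≤ ∑ i ∈ S, ‖y i‖ ^ q.toReal :=
            Finset.sum_le_sum fun i hi => Real.rpow_le_rpow hε (h i hi) hq0.le
        _ ≤ _ := Finset.sum_le_sum_of_subset_of_nonneg (Finset.subset_univ _)
            fun i _ _ => by positivity
    refine le_trans (le_of_eq ?_) (Real.rpow_le_rpow (by positivity) hsum (by positivity))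
    rw [Real.mul_rpow (by positivity) (by positivity), ← Real.rpow_mul hε,
      mul_one_div_cancel hq0.ne', Real.rpow_one]

/-- A Gilbert–Varshamov bound: words of length `l` that pairwise differ in at least half of
their letters. -/
theorem exists_code {σ : Type*} [Fintype σ] [DecidableEq σ] [Nonempty σ] (l : ℕ) :
    ∃ C : Finset (Fin l → σ), (∀ w ∈ C, ∀ v ∈ C, w ≠ v → l ≤ 2 * hammingDist w v) ∧
      Fintype.card σ ^ l ≤ 4 ^ l * C.card ^ 2 := by
  classical
  set Q := Fintype.card σ with hQ
  have hQ1 : 0 < Q := Fintype.card_pos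
  obtain ⟨C, hCmem, hmax⟩ := (Finset.univ.filter fun C : Finset (Fin l → σ) =>
      ∀ w ∈ C, ∀ v ∈ C, w ≠ v → l ≤ 2 * hammingDist w v).exists_max_image Finset.card
      ⟨∅, by simp⟩
  have hC := (Finset.mem_filter.1 hCmem).2
  refine ⟨C, hC, ?_⟩
  have hnear : ∀ v : Fin l → σ, ∃ w ∈ C, 2 * hammingDist w v ≤ l := by
    intro v
    by_contra! hcon
    have hv : v ∉ C := fun hv => by simpa using hcon v hv
    have := hmax (insert v C) (Finset.mem_filter.2 ⟨Finset.mem_univ _, ?_⟩)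
    · rw [Finset.card_insert_of_notMem hv] at this
      omega
    · intro w hw u hu hwu
      rcases Finset.mem_insert.1 hw with rfl | hwC <;>
        rcases Finset.mem_insert.1 hu with rfl | huC
      · exact absurd rfl hwu
      · rw [hammingDist_comm]; exact (hcon u huC).le
      · exact (hcon w hwC).le
      · exact hC w hwC u huC hwu
  have hball : ∀ w : Fin l → σ,
      (Finset.univ.filter fun v => 2 * hammingDist w v ≤ l).card ≤ 2 ^ l * Q ^ (l / 2) := by
    intro w
    have hsub : (Finset.univ.filter fun v => 2 * hammingDist w v ≤ l) ⊆
        (Finset.univ.filter fun D : Finset (Fin l) => D.card ≤ l / 2).biUnion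
          fun D => Fintype.piFinset fun i => if i ∈ D then Finset.univ else {w i} := by
      intro v hv
      have hv := (Finset.mem_filter.1 hv).2
      refine Finset.mem_biUnion.2 ⟨Finset.univ.filter fun i => w i ≠ v i, ?_, ?_⟩
      · refine Finset.mem_filter.2 ⟨Finset.mem_univ _, ?_⟩
        change hammingDist w v ≤ l / 2
        omega
      · rw [Fintype.mem_piFinset]
        intro i
        by_cases h : w i = v i <;> simp [h]
    refine (Finset.card_le_card hsub).trans (Finset.card_biUnion_le.trans ?_)
    calc _ ≤ ∑ _D ∈ Finset.univ.filter fun D : Finset (Fin l) => D.card ≤ l / 2, Q ^ (l / 2) := by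
          refine Finset.sum_le_sum fun D hD => ?_
          rw [Fintype.card_piFinset]
          have : ∀ i, (if i ∈ D then Finset.univ else {w i} : Finset σ).card =
              if i ∈ D then Q else 1 := fun i => by split_ifs <;> simp [hQ]
          simp only [this, Finset.prod_ite_mem, Finset.univ_inter, Finset.prod_const]
          exact Nat.pow_le_pow_right hQ1 (Finset.mem_filter.1 hD).2
      _ ≤ _ := by
          rw [Finset.sum_const, smul_eq_mul]
          refine Nat.mul_le_mul_right _ ((Finset.card_filter_le _ _).trans ?_)
          simp
  have htot : Q ^ l ≤ C.card * (2 ^ l * Q ^ (l / 2)) := by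
    have hsub : (Finset.univ : Finset (Fin l → σ)) ⊆
        C.biUnion fun w => Finset.univ.filter fun v => 2 * hammingDist w v ≤ l := by
      intro v _
      obtain ⟨w, hw, h⟩ := hnear v
      exact Finset.mem_biUnion.2 ⟨w, hw, by simpa using h⟩
    have := (Finset.card_le_card hsub).trans (Finset.card_biUnion_le_card_mul _ _ _
      fun w _ => hball w)
    simpa [hQ] using this
  have hhalf : Q ^ (l / 2) * Q ^ (l / 2) ≤ Q ^ l := by
    rw [← pow_add]; exact Nat.pow_le_pow_right hQ1 (by omega)
  refine Nat.le_of_mul_le_mul_right (c := Q ^ l) ?_ (by positivity)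
  calc Q ^ l * Q ^ l ≤ (C.card * (2 ^ l * Q ^ (l / 2))) * (C.card * (2 ^ l * Q ^ (l / 2))) :=
        Nat.mul_le_mul htot htot
    _ = (2 * 2) ^ l * C.card ^ 2 * (Q ^ (l / 2) * Q ^ (l / 2)) := by rw [mul_pow]; ring
    _ ≤ 4 ^ l * C.card ^ 2 * Q ^ l := Nat.mul_le_mul_left _ hhalf

/-- Words of length `l` over an alphabet of vectors of `X`, each placed at one of `N` positions
of its block, yield a lower bound for the entropy numbers of a diagonal operator. -/
theorem le_entropyNum_of_alphabet {X Y σ : Type*} [NormedAddCommGroup X] [NormedSpace ℝ X]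
    [NormedAddCommGroup Y] [NormedSpace ℝ Y] [Fintype σ] [Nonempty σ]
    {p q : ℝ≥0∞} [Fact (1 ≤ p)] [Fact (1 ≤ q)]
    {m n l N R : ℕ} (T0 : X →L[ℝ] Y)
    (T : PiLp p (fun _ : Fin m => X) →L[ℝ] PiLp q (fun _ : Fin m => Y))
    (hT : ∀ x i, T x i = T0 (x i)) (hn : 1 ≤ n) (hl : 1 ≤ l) (hlN : l * N ≤ m)
    (hR : 4 * R ≤ Fintype.card σ) (hRl : 4 ^ n ≤ R ^ l)
    (pos : σ → Fin N) (val : σ → X) (hval : ∀ a, ‖val a‖ ≤ 1) {ε : ℝ} (hε : 0 ≤ ε)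
    (hne : ∀ a b, pos a ≠ pos b → ε ≤ ‖T0 (val a)‖)
    (heq : ∀ a b, a ≠ b → pos a = pos b → ε ≤ ‖T0 (val a) - T0 (val b)‖) :
    ε / 4 * (1 / (l : ℝ)) ^ (1 / p.toReal - 1 / q.toReal) ≤ entropyNum n T := by
  classical
  have hl0 : (0 : ℝ) < l := by exact_mod_cast hl
  obtain ⟨C, hC, hcard⟩ := exists_code (σ := σ) l
  have hCcard : 2 ^ (n - 1) < C.card := by
    have h1 : 4 ^ l * 4 ^ n ≤ 4 ^ l * C.card ^ 2 := by
      calc 4 ^ l * 4 ^ n ≤ 4 ^ l * R ^ l := Nat.mul_le_mul_left _ hRl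
        _ = (4 * R) ^ l := (mul_pow _ _ _).symm
        _ ≤ _ := (Nat.pow_le_pow_left hR l).trans hcard
    have h2 : (2 ^ n) ^ 2 ≤ C.card ^ 2 := by
      rw [← pow_mul, mul_comm n 2, pow_mul]
      exact Nat.le_of_mul_le_mul_left h1 (by positivity)
    exact (Nat.pow_lt_pow_right (by norm_num) (by omega)).trans_le
      ((Nat.pow_le_pow_iff_left two_ne_zero).1 h2)
  let e : Fin l × Fin N → Fin m := fun b => Fin.castLE hlN (finProdFinEquiv b)
  have he : Function.Injective e :=
    (Fin.castLE_injective hlN).comp finProdFinEquiv.injective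
  let u : (Fin l → σ) → Fin m → X := fun w =>
    Function.extend e (fun b => if pos (w b.1) = b.2 then val (w b.1) else 0) 0
  have hu : ∀ w b, u w (e b) = if pos (w b.1) = b.2 then val (w b.1) else 0 :=
    fun w b => he.extend_apply _ _ _
  let c : ℝ := (1 / (l : ℝ)) ^ (1 / p.toReal)
  have hc : 0 ≤ c := by positivity
  have hinj : ∀ w : Fin l → σ, Function.Injective fun b => e (b, pos (w b)) :=
    fun w b b' h => (Prod.ext_iff.1 (he h)).1
  refine le_entropyNum_of_separated C hCcard (fun w => WithLp.toLp p (c • u w)) ?_ ?_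
  · intro w _
    let D : Finset (Fin m) := Finset.univ.image fun b => e (b, pos (w b))
    have hD : D.card = l := by
      rw [Finset.card_image_of_injective _ (hinj w), Finset.card_univ, Fintype.card_fin]
    have := norm_piLp_le_of_forall_le (WithLp.toLp p (c • u w)) (B := 1) (s := 1)
      (a := fun i => if i ∈ D then 1 / (l : ℝ) else 0) zero_le_one
      (fun i => by split_ifs <;> positivity) ?_ ?_
    · simpa using this
    · rw [Finset.sum_ite_mem, Finset.univ_inter, Finset.sum_const, hD, nsmul_eq_mul]
      exact (mul_one_div_cancel hl0.ne').le
    · intro i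
      have hval0 : i ∈ D ∧ ‖u w i‖ ≤ 1 ∨ u w i = 0 := by
        by_cases hi : ∃ b, e b = i
        · obtain ⟨b, rfl⟩ := hi
          rw [hu]
          split_ifs with h
          · exact Or.inl ⟨Finset.mem_image.2 ⟨b.1, Finset.mem_univ _, by rw [h]⟩, hval _⟩
          · exact Or.inr rfl
        · exact Or.inr (Function.extend_apply' _ _ _ hi)
      rcases hval0 with ⟨hi, h⟩ | h
      · simp only [Pi.smul_apply, norm_smul, Real.norm_of_nonneg hc, hi, if_true,
          one_mul]
        exact mul_le_of_le_one_right hc h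
      · simp only [Pi.smul_apply, h, smul_zero, norm_zero, one_mul]
        exact Real.rpow_nonneg (by split_ifs <;> positivity) _
  · intro w hw v hv hwv
    have hdist := hC w hw v hv hwv
    let D : Finset (Fin m) := (Finset.univ.filter fun b => w b ≠ v b).image
      fun b => e (b, pos (w b))
    have hD : D.card = hammingDist w v := Finset.card_image_of_injective _ (hinj w)
    have hDpos : 0 < D.card := by omega
    have hlD : (l : ℝ) / 2 ≤ D.card := by
      have : (l : ℝ) ≤ 2 * D.card := by rw [hD]; exact_mod_cast hdist
      linarith
    have hmain := card_rpow_mul_le_norm_piLp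
      (T (WithLp.toLp p (c • u w)) - T (WithLp.toLp p (c • u v))) (ε := c * ε)
      (by positivity) D (Finset.card_pos.1 hDpos) ?_
    · refine le_trans ?_ hmain
      have hq1 : 1 / q.toReal ≤ 1 := by
        rcases eq_or_ne q ∞ with rfl | hq
        · simp
        · exact div_le_one_of_le₀ (by simpa using ENNReal.toReal_mono hq (Fact.out : 1 ≤ q))
            ENNReal.toReal_nonneg
      have h1 : (l : ℝ) ^ (1 / q.toReal) / 2 ≤ (D.card : ℝ) ^ (1 / q.toReal) := by
        refine le_trans ?_ (Real.rpow_le_rpow (by positivity) hlD (by positivity))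
        rw [Real.div_rpow hl0.le zero_le_two]
        refine div_le_div_of_nonneg_left (by positivity) (by positivity) ?_
        exact (Real.rpow_le_rpow_of_exponent_le one_le_two hq1).trans_eq (Real.rpow_one 2)
      have h2 : (1 / (l : ℝ)) ^ (1 / p.toReal - 1 / q.toReal) = c * (l : ℝ) ^ (1 / q.toReal) := by
        rw [Real.rpow_sub (by positivity), one_div, Real.inv_rpow hl0.le (1 / q.toReal),
          div_inv_eq_mul, ← one_div]
      rw [h2]
      calc _ = (l : ℝ) ^ (1 / q.toReal) / 2 * (c * ε) := by ring
        _ ≤ _ := by gcongr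
    · intro i hi
      obtain ⟨b, hb, rfl⟩ := Finset.mem_image.1 hi
      have hb := (Finset.mem_filter.1 hb).2
      have hTe : (T (WithLp.toLp p (c • u w)) - T (WithLp.toLp p (c • u v))) (e (b, pos (w b))) =
          c • (T0 (val (w b)) - T0 (u v (e (b, pos (w b))))) := by
        simp only [PiLp.sub_apply, hT, Pi.smul_apply, map_smul, smul_sub, hu, if_true]
      rw [hTe, norm_smul, Real.norm_of_nonneg hc]
      refine mul_le_mul_of_nonneg_left ?_ hc
      rw [hu]
      split_ifs with h
      · exact heq _ _ hb h.symm
      · simpa using hne _ _ (Ne.symm h)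

/-- Elementary bounds for the exponent `1 / p - 1 / q`. -/
theorem one_div_sub_one_div_mem_Ioc {p q : ℝ≥0∞} [Fact (1 ≤ p)] (hpq : p < q) :
    0 < 1 / p.toReal - 1 / q.toReal ∧ 1 / p.toReal - 1 / q.toReal ≤ 1 := by
  have hp : p ≠ ∞ := hpq.ne_top
  have hp1 : 1 ≤ p.toReal := by simpa using ENNReal.toReal_mono hp (Fact.out : 1 ≤ p)
  refine ⟨?_, ?_⟩
  · rcases eq_or_ne q ∞ with rfl | hq
    · simp; linarith
    · exact sub_pos.2 (one_div_lt_one_div_of_lt (by linarith) (ENNReal.toReal_strict_mono hq hpq))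
  · have h1 : 1 / p.toReal ≤ 1 := div_le_one_of_le₀ hp1 (by linarith)
    have h2 : 0 ≤ 1 / q.toReal := by positivity
    linarith

theorem div_rpow_le_rpow_div {x c α : ℝ} (hx : 0 ≤ x) (hc : 1 ≤ c) (hα : α ≤ 1) :
    x ^ α / c ≤ (x / c) ^ α := by
  have hc0 : 0 < c := by linarith
  rw [Real.div_rpow hx hc0.le]
  refine div_le_div_of_nonneg_left (by positivity) (by positivity) ?_
  exact (Real.rpow_le_rpow_of_exponent_le hc hα).trans_eq (Real.rpow_one c)

theorem one_le_logb_div_add_one {m n : ℕ} (hn : 1 ≤ n) (hnm : n ≤ m) :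
    1 ≤ Real.logb 2 ((m : ℝ) / n) + 1 := by
  have hn0 : (0 : ℝ) < n := by exact_mod_cast hn
  have : 1 ≤ (m : ℝ) / n := (one_le_div hn0).2 (by exact_mod_cast hnm)
  linarith [Real.logb_nonneg one_lt_two this]

theorem logb_div_add_one_le {m n : ℕ} (hn : 2 ≤ n) (hnm : n ≤ m) (hm2 : m ≤ 2 ^ n) :
    Real.logb 2 ((m : ℝ) / n) + 1 ≤ n := by
  have hn0 : (2 : ℝ) ≤ n := by exact_mod_cast hn
  have hm0 : (0 : ℝ) < m := by exact_mod_cast (by omega : 0 < m)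
  have hm : (m : ℝ) ≤ 2 ^ n := by exact_mod_cast hm2
  have h1 : Real.logb 2 m ≤ n := by
    rw [Real.logb_le_iff_le_rpow one_lt_two hm0]; simpa using hm
  have h2 : 1 ≤ Real.logb 2 n := by
    rw [Real.le_logb_iff_rpow_le one_lt_two (by linarith)]; simpa using hn0
  rw [Real.logb_div hm0.ne' (by linarith)]
  linarith

theorem opNorm_mul_rpow_le_entropyNum {X Y : Type*} [NormedAddCommGroup X] [NormedSpace ℝ X]
    [NormedAddCommGroup Y] [NormedSpace ℝ Y] {p q : ℝ≥0∞} [Fact (1 ≤ p)] [Fact (1 ≤ q)]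
    (hpq : p < q) {m n : ℕ} (hn : 2 ≤ n) (hnm : n ≤ m) (hm2 : m ≤ 2 ^ n) (T0 : X →L[ℝ] Y)
    (T : PiLp p (fun _ : Fin m => X) →L[ℝ] PiLp q (fun _ : Fin m => Y))
    (hT : ∀ x i, T x i = T0 (x i)) :
    ‖T0‖ * ((Real.logb 2 ((m : ℝ) / n) + 1) / n) ^ (1 / p.toReal - 1 / q.toReal) ≤
      2560 * entropyNum n T := by
  obtain ⟨hα0, hα1⟩ := one_div_sub_one_div_mem_Ioc hpq
  rcases (norm_nonneg T0).eq_or_lt with h0 | h0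
  · rw [← h0]
    simpa using entropyNum_nonneg n T
  obtain ⟨x, hx1, hx⟩ : ∃ x, ‖x‖ ≤ 1 ∧ ‖T0‖ / 2 ≤ ‖T0 x‖ := by
    obtain ⟨x, hx, h⟩ := T0.exists_lt_apply_of_lt_opNorm (half_lt_self h0)
    exact ⟨x, hx.le, h.le⟩
  set lam := Real.logb 2 ((m : ℝ) / n) + 1 with hlam
  have hlam1 : 1 ≤ lam := one_le_logb_div_add_one (by omega) hnm
  have hlamn : lam ≤ n := logb_div_add_one_le hn hnm hm2
  have hn0 : (2 : ℝ) ≤ n := by exact_mod_cast hn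
  have hm0 : (0 : ℝ) < m := by exact_mod_cast (by omega : 0 < m)
  obtain ⟨l, hl⟩ : ∃ l, l = min n ⌈4 * n / lam⌉₊ := ⟨_, rfl⟩
  have hl1 : 1 ≤ l := by
    rw [hl]
    exact le_min (by omega) (Nat.one_le_ceil_iff.2 (by positivity))
  have hln : l ≤ n := hl ▸ min_le_left _ _
  have hl0 : (0 : ℝ) < l := by exact_mod_cast hl1
  have hl5 : (l : ℝ) ≤ 5 * n / lam := by
    have h1 : (l : ℝ) ≤ ⌈4 * n / lam⌉₊ := by rw [hl]; exact_mod_cast min_le_right _ _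
    have h2 := Nat.ceil_lt_add_one (show 0 ≤ 4 * n / lam by positivity)
    have h3 : 1 ≤ n / lam := (one_le_div (by linarith)).2 hlamn
    calc (l : ℝ) ≤ 4 * n / lam + n / lam := by linarith
      _ = _ := by ring
  have hN1 : 1 ≤ m / l := (Nat.one_le_div_iff hl1).2 (hln.trans hnm)
  have hRl : 4 ^ n ≤ (16 * (m / l)) ^ l := by
    rcases le_total n ⌈4 * n / lam⌉₊ with h | h
    · rw [min_eq_left h] at hl
      rw [hl] at hN1 ⊢
      exact Nat.pow_le_pow_left (by omega) n
    · rw [min_eq_right h] at hl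
      have hl4 : 4 * n / lam ≤ l := hl ▸ Nat.le_ceil _
      have hbase : (2 : ℝ) ^ lam ≤ ((16 * (m / l) : ℕ) : ℝ) := by
        have h1 : m ≤ 2 * (m / l) * n := by
          have h2 : m < (m / l + 1) * l := Nat.lt_mul_of_div_lt (Nat.lt_succ_self _) hl1
          calc m ≤ (m / l + 1) * l := h2.le
            _ ≤ 2 * (m / l) * n := Nat.mul_le_mul (by omega) hln
        have h3 : (m : ℝ) / n ≤ 2 * ((m / l : ℕ) : ℝ) := by
          rw [div_le_iff₀ (by linarith)]; exact_mod_cast h1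
        rw [hlam, Real.rpow_add two_pos, Real.rpow_logb two_pos (by norm_num) (by positivity),
          Real.rpow_one]
        push_cast at h3 ⊢
        have h4 : 0 ≤ (m : ℝ) / n := by positivity
        linarith
      have hexp : (2 * n : ℝ) ≤ lam * l := by
        rw [div_le_iff₀ (by linarith)] at hl4
        linarith
      have : (4 : ℝ) ^ n ≤ ((16 * (m / l) : ℕ) : ℝ) ^ l := by
        calc (4 : ℝ) ^ n = (2 : ℝ) ^ (2 * n : ℝ) := by
              rw [Real.rpow_mul zero_le_two, Real.rpow_natCast]; norm_num
          _ ≤ (2 : ℝ) ^ (lam * l) := Real.rpow_le_rpow_of_exponent_le one_le_two hexp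
          _ = ((2 : ℝ) ^ lam) ^ l := by rw [Real.rpow_mul zero_le_two, Real.rpow_natCast]
          _ ≤ _ := by gcongr
      exact_mod_cast this
  have : NeZero (m / l) := ⟨by omega⟩
  have hkey := le_entropyNum_of_alphabet (σ := Fin (m / l) × Fin 64) (N := m / l)
    (R := 16 * (m / l)) (ε := ‖T0‖ / 128) T0 T hT (by omega) hl1 (Nat.mul_div_le m l)
    (by simp only [Fintype.card_prod, Fintype.card_fin]; omega) hRl Prod.fst
    (fun a => (((a.2 : ℕ) + 1 : ℝ) / 64) • x) ?_ (by positivity) ?_ ?_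
  · have h1 : lam / n / 5 ≤ 1 / (l : ℝ) := by
      rw [le_div_iff₀ hl0]
      rw [le_div_iff₀ (by linarith)] at hl5
      rw [div_div, div_mul_eq_mul_div, div_le_one (by linarith)]
      linarith
    have h2 := Real.rpow_le_rpow (by positivity) h1 hα0.le
    have h3 := div_rpow_le_rpow_div (x := lam / n) (c := 5) (by positivity) (by norm_num) hα1
    have h4 := mul_le_mul_of_nonneg_left (h3.trans h2) (show 0 ≤ ‖T0‖ / 128 / 4 by positivity)
    linarith
  · intro a
    have ha : ((a.2 : ℕ) : ℝ) + 1 ≤ 64 := by exact_mod_cast a.2.2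
    rw [norm_smul, Real.norm_of_nonneg (by positivity)]
    exact mul_le_one₀ (by linarith) (norm_nonneg x) hx1
  · intro a b _
    rw [map_smul, norm_smul, Real.norm_of_nonneg (by positivity)]
    have : (0 : ℝ) ≤ (a.2 : ℕ) := by positivity
    nlinarith
  · rintro ⟨i, a⟩ ⟨j, b⟩ hab (rfl : i = j)
    have hab' : ((a : ℕ) : ℤ) - (b : ℕ) ≠ 0 := by
      intro h
      exact hab (Prod.ext rfl (Fin.ext (by simpa using (by omega : (a : ℕ) = b))))
    have hab'' : (1 : ℝ) ≤ |((a : ℕ) : ℝ) - (b : ℕ)| := by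
      exact_mod_cast Int.one_le_abs hab'
    have : T0 ((((a : ℕ) + 1 : ℝ) / 64) • x) - T0 ((((b : ℕ) + 1 : ℝ) / 64) • x) =
        ((((a : ℕ) : ℝ) - (b : ℕ)) / 64) • T0 x := by
      rw [map_smul, map_smul, ← sub_smul]; congr 1; ring
    simp only
    rw [this, norm_smul, norm_div, Real.norm_eq_abs, Real.norm_of_nonneg (by norm_num)]
    nlinarith

theorem rpow_mul_entropyNum_le_entropyNum {X Y : Type*} [NormedAddCommGroup X] [NormedSpace ℝ X]
    [NormedAddCommGroup Y] [NormedSpace ℝ Y] {p q : ℝ≥0∞} [Fact (1 ≤ p)] [Fact (1 ≤ q)]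
    (hpq : p < q) {m n k : ℕ} (hk : 6 ≤ k) (hkn : k ≤ n) (hnm : n ≤ m) (T0 : X →L[ℝ] Y)
    (T : PiLp p (fun _ : Fin m => X) →L[ℝ] PiLp q (fun _ : Fin m => Y))
    (hT : ∀ x i, T x i = T0 (x i)) :
    ((k : ℝ) / n) ^ (1 / p.toReal - 1 / q.toReal) * entropyNum k T0 ≤ 40 * entropyNum n T := by
  classical
  obtain ⟨hα0, hα1⟩ := one_div_sub_one_div_mem_Ioc hpq
  rcases (entropyNum_nonneg k T0).eq_or_lt with h0 | h0
  · rw [← h0]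
    simpa using entropyNum_nonneg n T
  obtain ⟨C, hCcard, hC1, hCsep⟩ :=
    exists_separated_of_lt_entropyNum (half_pos h0) (half_lt_self h0)
  have hk0 : (6 : ℝ) ≤ k := by exact_mod_cast hk
  have hkn' : (k : ℝ) ≤ n := by exact_mod_cast hkn
  obtain ⟨l, hl⟩ : ∃ l, l = ⌈4 * n / (k : ℝ)⌉₊ := ⟨_, rfl⟩
  have hn0 : (0 : ℝ) < n := by linarith
  have hl1 : 1 ≤ l := hl ▸ Nat.one_le_ceil_iff.2 (by positivity)
  have hl0 : (0 : ℝ) < l := by exact_mod_cast hl1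
  have hln : l ≤ n := by
    rw [hl, Nat.ceil_le, div_le_iff₀ (by linarith)]
    nlinarith
  have hl4 : 4 * n ≤ l * k := by
    have : 4 * n / (k : ℝ) ≤ l := hl ▸ Nat.le_ceil _
    rw [div_le_iff₀ (by linarith)] at this
    exact_mod_cast this
  have hl5 : (l : ℝ) * k ≤ 5 * n := by
    have h2 := Nat.ceil_lt_add_one (show 0 ≤ 4 * n / (k : ℝ) by positivity)
    rw [← hl, ← sub_lt_iff_lt_add, lt_div_iff₀ (by linarith)] at h2
    linarith
  have : Nonempty C := by
    rw [Finset.nonempty_coe_sort, ← Finset.card_pos, hCcard]; positivity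
  have hkey := le_entropyNum_of_alphabet (σ := C) (n := n) (N := 1) (R := 2 ^ (k - 3))
    (ε := entropyNum k T0 / 2) T0 T hT (by omega) hl1 (by omega)
    (by
      rw [Fintype.card_coe, hCcard, show k - 1 = 2 + (k - 3) by omega, pow_add]
      norm_num)
    (by
      rw [show (4 : ℕ) = 2 ^ 2 by norm_num, ← pow_mul, ← pow_mul]
      refine Nat.pow_le_pow_right (by norm_num) ?_
      have h3 : k ≤ 2 * (k - 3) := by omega
      have h4 := Nat.mul_le_mul_left l h3
      nlinarith)
    (fun _ => 0) (fun a => a.1) (fun a => hC1 _ a.2) (half_pos h0).le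
    (fun a b h => absurd rfl h)
    (fun a b h _ => hCsep _ a.2 _ b.2 (fun h' => h (Subtype.ext h')))
  have h1 : (k : ℝ) / n / 5 ≤ 1 / (l : ℝ) := by
    rw [le_div_iff₀ hl0, div_div, div_mul_eq_mul_div, div_le_one (by linarith)]
    linarith
  have h2 := Real.rpow_le_rpow (by positivity) h1 hα0.le
  have h3 := div_rpow_le_rpow_div (x := (k : ℝ) / n) (c := 5) (by positivity) (by norm_num) hα1
  have h4 := mul_le_mul_of_nonneg_left (h3.trans h2)
    (show 0 ≤ entropyNum k T0 / 2 / 4 by positivity)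
  linarith

/-- Weighted count of the sparse integer vectors with bounded sum. -/
theorem sum_two_pow_sum_le {m n : ℕ} {s M z : ℝ} (hz : 0 < z) (hz1 : z ≤ 1) :
    ∑ k ∈ (Fintype.piFinset fun _ : Fin m => Finset.range (n + 1)).filter
        (fun k => ((Finset.univ.filter fun i => k i ≠ 0).card : ℝ) ≤ s ∧
          ((∑ i, k i : ℕ) : ℝ) ≤ M), (2 : ℝ) ^ (∑ i, k i) ≤
      z ^ (-s) * 4 ^ M * Real.exp (z * m) := by
  let f : ℕ → ℝ := fun k => (if k ≠ 0 then z else 1) * (1 / 2) ^ k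
  have hf0 : ∀ k, 0 ≤ f k := fun k => by
    have : 0 ≤ if k ≠ 0 then z else 1 := by split_ifs <;> linarith
    positivity
  have hfsum : ∑ k ∈ Finset.range (n + 1), f k ≤ Real.exp z := by
    have h1 : ∑ k ∈ Finset.range n, f (k + 1) = z / 2 * ∑ k ∈ Finset.range n, (1 / 2 : ℝ) ^ k := by
      rw [Finset.mul_sum]
      refine Finset.sum_congr rfl fun k _ => ?_
      simp only [f, ne_eq, Nat.add_eq_zero_iff, one_ne_zero, and_false, not_false_eq_true, if_true,
        pow_succ]
      ring
    have h2 := sum_geometric_two_le n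
    have h3 := Real.add_one_le_exp z
    rw [Finset.sum_range_succ', h1]
    simp only [f, ne_eq, not_true_eq_false, if_false, pow_zero]
    nlinarith
  have hprod : ∀ k : Fin m → ℕ, ∏ i, f (k i) =
      z ^ (Finset.univ.filter fun i => k i ≠ 0).card * (1 / 2) ^ (∑ i, k i) := by
    intro k
    simp only [f]
    rw [Finset.prod_mul_distrib, Finset.prod_pow_eq_pow_sum, Finset.prod_ite]
    simp
  have hterm : ∀ k : Fin m → ℕ, ((Finset.univ.filter fun i => k i ≠ 0).card : ℝ) ≤ s →
      ((∑ i, k i : ℕ) : ℝ) ≤ M →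
      (2 : ℝ) ^ (∑ i, k i) ≤ z ^ (-s) * 4 ^ M * ∏ i, f (k i) := by
    intro k hs hM
    rw [hprod]
    generalize (Finset.univ.filter fun i => k i ≠ 0).card = j at hs
    generalize ∑ i, k i = t at hM
    have h1 : 1 ≤ z ^ (-s) * z ^ j := by
      rw [← Real.rpow_natCast z j, ← Real.rpow_add hz]
      exact Real.one_le_rpow_of_pos_of_le_one_of_nonpos hz hz1 (by linarith)
    have h2 : (2 : ℝ) ^ t ≤ 4 ^ M * (1 / 2) ^ t := by
      have h4 : (4 : ℝ) ^ t ≤ 4 ^ M := by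
        rw [← Real.rpow_natCast]
        exact Real.rpow_le_rpow_of_exponent_le (by norm_num) hM
      calc (2 : ℝ) ^ t = 4 ^ t * (1 / 2) ^ t := by rw [← mul_pow]; norm_num
        _ ≤ _ := by gcongr
    calc (2 : ℝ) ^ t ≤ (z ^ (-s) * z ^ j) * (4 ^ M * (1 / 2) ^ t) :=
          h2.trans (le_mul_of_one_le_left (by positivity) h1)
      _ = _ := by ring
  calc _ ≤ ∑ k ∈ (Fintype.piFinset fun _ : Fin m => Finset.range (n + 1)).filter
        (fun k => ((Finset.univ.filter fun i => k i ≠ 0).card : ℝ) ≤ s ∧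
          ((∑ i, k i : ℕ) : ℝ) ≤ M), z ^ (-s) * 4 ^ M * ∏ i, f (k i) :=
        Finset.sum_le_sum fun k hk =>
          hterm k (Finset.mem_filter.1 hk).2.1 (Finset.mem_filter.1 hk).2.2
    _ ≤ ∑ k ∈ Fintype.piFinset fun _ : Fin m => Finset.range (n + 1),
          z ^ (-s) * 4 ^ M * ∏ i, f (k i) :=
        Finset.sum_le_sum_of_subset_of_nonneg (Finset.filter_subset _ _) fun k _ _ =>
          mul_nonneg (by positivity) (Finset.prod_nonneg fun i _ => hf0 _)
    _ = z ^ (-s) * 4 ^ M * (∑ k ∈ Finset.range (n + 1), f k) ^ m := by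
        rw [← Finset.mul_sum, ← Finset.prod_univ_sum]; simp
    _ ≤ z ^ (-s) * 4 ^ M * (Real.exp z) ^ m := by
        have := Finset.sum_nonneg fun k (_ : k ∈ Finset.range (n + 1)) => hf0 k
        gcongr
    _ = _ := by rw [← Real.exp_nat_mul, mul_comm z]

theorem count_bound_le_two_pow {m n : ℕ} (hn : 2 ≤ n) (hnm : n ≤ m) {lam : ℝ}
    (hlam : lam = Real.logb 2 ((m : ℝ) / n) + 1) :
    ((n : ℝ) / (64 * lam * m)) ^ (-(n / (64 * lam))) * 4 ^ ((n : ℝ) / 8 + n / (64 * lam)) *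
      Real.exp ((n : ℝ) / (64 * lam * m) * m) ≤ 2 ^ (n - 1) := by
  have hlam1 : 1 ≤ lam := hlam ▸ one_le_logb_div_add_one (by omega) hnm
  have hn0 : (2 : ℝ) ≤ n := by exact_mod_cast hn
  have hm0 : (0 : ℝ) < m := by exact_mod_cast (by omega : 0 < m)
  set s := (n : ℝ) / (64 * lam) with hs
  have hs0 : 0 ≤ s := by positivity
  have hslam : s * lam = n / 64 := by rw [hs]; field_simp
  have hsn : s ≤ n / 64 := by nlinarith
  have h1 : ((n : ℝ) / (64 * lam * m)) ^ (-s) ≤ 2 ^ ((n : ℝ) / 8) := by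
    have hbase : 64 * lam * m / n ≤ (2 : ℝ) ^ (8 * lam) := by
      have hmn : (m : ℝ) / n = 2 ^ (lam - 1) := by
        rw [hlam, add_sub_cancel_right, Real.rpow_logb two_pos (by norm_num) (by positivity)]
      have hle : lam ≤ (2 : ℝ) ^ lam := by
        have := one_add_mul_self_le_rpow_one_add (s := 1) (by norm_num) hlam1
        norm_num at this
        linarith
      calc 64 * lam * m / n = 64 * lam * (m / n) := by ring
        _ ≤ 2 ^ (6 : ℝ) * 2 ^ lam * 2 ^ (lam - 1) := by
            rw [hmn]
            have : (2 : ℝ) ^ (6 : ℝ) = 64 := by norm_num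
            rw [this]
            gcongr
        _ = 2 ^ (6 + lam + (lam - 1)) := by rw [Real.rpow_add two_pos, Real.rpow_add two_pos]
        _ ≤ _ := Real.rpow_le_rpow_of_exponent_le one_le_two (by linarith)
    rw [Real.rpow_neg (by positivity), ← Real.inv_rpow (by positivity), inv_div]
    calc (64 * lam * m / n) ^ s ≤ ((2 : ℝ) ^ (8 * lam)) ^ s := by gcongr
      _ = 2 ^ ((n : ℝ) / 8) := by
          rw [← Real.rpow_mul zero_le_two]; congr 1; linarith
  have h2 : (4 : ℝ) ^ ((n : ℝ) / 8 + s) ≤ 2 ^ ((n : ℝ) / 4 + n / 32) := by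
    rw [show (4 : ℝ) = 2 ^ (2 : ℝ) by norm_num, ← Real.rpow_mul zero_le_two]
    exact Real.rpow_le_rpow_of_exponent_le one_le_two (by linarith)
  have h3 : Real.exp ((n : ℝ) / (64 * lam * m) * m) ≤ 2 ^ ((n : ℝ) / 32) := by
    have : (n : ℝ) / (64 * lam * m) * m = s := by rw [hs]; field_simp
    rw [this, ← Real.exp_one_rpow]
    calc Real.exp 1 ^ s ≤ ((2 : ℝ) ^ (2 : ℝ)) ^ s := by
          refine Real.rpow_le_rpow (Real.exp_pos _).le ?_ hs0
          have := Real.exp_one_lt_d9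
          norm_num
          linarith
      _ ≤ _ := by
          rw [← Real.rpow_mul zero_le_two]
          exact Real.rpow_le_rpow_of_exponent_le one_le_two (by linarith)
  calc _ ≤ (2 : ℝ) ^ ((n : ℝ) / 8) * 2 ^ ((n : ℝ) / 4 + n / 32) * 2 ^ ((n : ℝ) / 32) := by gcongr
    _ = 2 ^ ((n : ℝ) / 8 + (n / 4 + n / 32) + n / 32) := by
        rw [← Real.rpow_add two_pos, ← Real.rpow_add two_pos]
    _ ≤ (2 : ℝ) ^ (((n - 1 : ℕ) : ℝ)) := by
        refine Real.rpow_le_rpow_of_exponent_le one_le_two ?_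
        rw [Nat.cast_sub (by omega), Nat.cast_one]
        linarith
    _ = _ := Real.rpow_natCast _ _

/-- Covering a scaled ball when the entropy numbers are controlled by `A`. -/
theorem exists_scaled_cover {X Y : Type*} [NormedAddCommGroup X] [NormedSpace ℝ X]
    [NormedAddCommGroup Y] [NormedSpace ℝ Y] {p q : ℝ≥0∞} [Fact (1 ≤ p)] (hp : p ≠ ∞)
    {n k : ℕ} (hk : 1 ≤ k) (hkn : k ≤ n) {A : ℝ} (hA : 0 < A) (T0 : X →L[ℝ] Y)
    (hent : ((k : ℝ) / n) ^ (1 / p.toReal - 1 / q.toReal) * entropyNum k T0 ≤ A) :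
    ∃ G : Finset Y, G.card ≤ 2 ^ k ∧ ∀ x, ‖x‖ ≤ (8 * k / n : ℝ) ^ (1 / p.toReal) →
      ∃ y ∈ G, ‖T0 x - y‖ ≤ 16 * A * ((k : ℝ) / n) ^ (1 / q.toReal) := by
  classical
  have hk0 : (0 : ℝ) < k := by exact_mod_cast hk
  have hn0 : (0 : ℝ) < n := hk0.trans_le (by exact_mod_cast hkn)
  have hp1 : 1 ≤ p.toReal := by simpa using ENNReal.toReal_mono hp (Fact.out : 1 ≤ p)
  set α := 1 / p.toReal - 1 / q.toReal with hα
  have hkα : 0 < ((k : ℝ) / n) ^ α := by positivity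
  have hlt : entropyNum k T0 < 2 * A / ((k : ℝ) / n) ^ α := by
    rw [lt_div_iff₀ hkα]
    linarith
  obtain ⟨S, hS, hcov⟩ := exists_cover_of_entropyNum_lt hlt
  set ρ : ℝ := (8 * k / n : ℝ) ^ (1 / p.toReal) with hρ
  have hρ0 : 0 < ρ := by positivity
  refine ⟨S.image fun y => ρ • y, Finset.card_image_le.trans
    (hS.trans (Nat.pow_le_pow_right two_pos (Nat.sub_le k 1))), fun x hx => ?_⟩
  obtain ⟨y, hy, hd⟩ := hcov (ρ⁻¹ • x) (by
    rw [norm_smul, norm_inv, Real.norm_of_nonneg hρ0.le, inv_mul_le_iff₀ hρ0]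
    simpa using hx)
  refine ⟨ρ • y, Finset.mem_image_of_mem _ hy, ?_⟩
  have hx' : T0 x - ρ • y = ρ • (T0 (ρ⁻¹ • x) - y) := by
    rw [map_smul, smul_sub, smul_inv_smul₀ hρ0.ne']
  rw [hx', norm_smul, Real.norm_of_nonneg hρ0.le]
  have h8 : (8 : ℝ) ^ (1 / p.toReal) ≤ 8 :=
    (Real.rpow_le_rpow_of_exponent_le (by norm_num)
      (div_le_one_of_le₀ hp1 (by linarith))).trans_eq (Real.rpow_one 8)
  have hsplit : ρ = 8 ^ (1 / p.toReal) * (((k : ℝ) / n) ^ α * ((k : ℝ) / n) ^ (1 / q.toReal)) := by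
    rw [← Real.rpow_add (by positivity), hα, sub_add_cancel, ← Real.mul_rpow (by norm_num)
      (by positivity), hρ, mul_div_assoc]
  calc ρ * ‖T0 (ρ⁻¹ • x) - y‖ ≤ ρ * (2 * A / ((k : ℝ) / n) ^ α) := by gcongr
    _ = 8 ^ (1 / p.toReal) * (2 * A) * ((k : ℝ) / n) ^ (1 / q.toReal) := by
        rw [hsplit]; field_simp
    _ ≤ 8 * (2 * A) * ((k : ℝ) / n) ^ (1 / q.toReal) := by gcongr
    _ = _ := by ring

theorem norm_apply_le_of_rpow_le {X Y : Type*} [NormedAddCommGroup X] [NormedSpace ℝ X]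
    [NormedAddCommGroup Y] [NormedSpace ℝ Y] {P r τ : ℝ} (hP : 0 < P)
    (hα : 0 ≤ 1 / P - r) (T0 : X →L[ℝ] Y) {x : X}
    (hx : ‖x‖ ^ P ≤ τ) : ‖T0 x‖ ≤ ‖T0‖ * τ ^ (1 / P - r) * (‖x‖ ^ P) ^ r := by
  have hx0 : ‖x‖ ≤ τ ^ (1 / P - r) * (‖x‖ ^ P) ^ r := by
    rcases (norm_nonneg x).eq_or_lt with h | h
    · rw [← h] at hx ⊢
      rw [Real.zero_rpow hP.ne'] at hx
      positivity
    · calc ‖x‖ = (‖x‖ ^ P) ^ (1 / P - r) * (‖x‖ ^ P) ^ r := by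
            rw [← Real.rpow_add (by positivity), sub_add_cancel, ← Real.rpow_mul h.le,
              mul_one_div_cancel hP.ne', Real.rpow_one]
        _ ≤ _ := by gcongr
  calc ‖T0 x‖ ≤ ‖T0‖ * ‖x‖ := T0.le_opNorm x
    _ ≤ ‖T0‖ * (τ ^ (1 / P - r) * (‖x‖ ^ P) ^ r) := by gcongr
    _ = _ := by ring

theorem entropyNum_diagonal_le {X Y : Type*} [NormedAddCommGroup X] [NormedSpace ℝ X]
    [NormedAddCommGroup Y] [NormedSpace ℝ Y] {p q : ℝ≥0∞} [Fact (1 ≤ p)] [Fact (1 ≤ q)]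
    (hpq : p < q) {m n : ℕ} (hn : 2 ≤ n) (hnm : n ≤ m) (T0 : X →L[ℝ] Y)
    (T : PiLp p (fun _ : Fin m => X) →L[ℝ] PiLp q (fun _ : Fin m => Y))
    (hT : ∀ x i, T x i = T0 (x i)) {A : ℝ} (hA : 0 < A)
    (hA1 : ‖T0‖ * ((Real.logb 2 ((m : ℝ) / n) + 1) / n) ^ (1 / p.toReal - 1 / q.toReal) ≤ A)
    (hA2 : ∀ k, 1 ≤ k → k ≤ n →
      ((k : ℝ) / n) ^ (1 / p.toReal - 1 / q.toReal) * entropyNum k T0 ≤ A) :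
    entropyNum n T ≤ 128 * A := by
  classical
  obtain ⟨hα0, hα1⟩ := one_div_sub_one_div_mem_Ioc hpq
  have hp : p ≠ ∞ := hpq.ne_top
  have hp1 : 1 ≤ p.toReal := by simpa using ENNReal.toReal_mono hp (Fact.out : 1 ≤ p)
  have hp0 : 0 < p.toReal := by linarith
  obtain ⟨lam, hlam⟩ : ∃ lam, lam = Real.logb 2 ((m : ℝ) / n) + 1 := ⟨_, rfl⟩
  rw [← hlam] at hA1
  have hlam1 : 1 ≤ lam := hlam ▸ one_le_logb_div_add_one (by omega) hnm
  have hn0 : (2 : ℝ) ≤ n := by exact_mod_cast hn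
  have hnm' : (n : ℝ) ≤ m := by exact_mod_cast hnm
  have hm0 : (0 : ℝ) < m := by linarith
  set s := (n : ℝ) / (64 * lam) with hs
  have hs0 : 0 < s := by positivity
  set K := (Fintype.piFinset fun _ : Fin m => Finset.range (n + 1)).filter
    (fun k => ((Finset.univ.filter fun i => k i ≠ 0).card : ℝ) ≤ s ∧
      ((∑ i, k i : ℕ) : ℝ) ≤ n / 8 + s)
  have hcover : ∀ k : ℕ, ∃ G : Finset Y, G.card ≤ 2 ^ k ∧ (k = 0 → 0 ∈ G) ∧ (1 ≤ k → k ≤ n →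
      ∀ x, ‖x‖ ≤ (8 * k / n : ℝ) ^ (1 / p.toReal) →
        ∃ y ∈ G, ‖T0 x - y‖ ≤ 16 * A * ((k : ℝ) / n) ^ (1 / q.toReal)) := by
    intro k
    by_cases hk : 1 ≤ k ∧ k ≤ n
    · obtain ⟨G, hG, h⟩ := exists_scaled_cover (q := q) hp hk.1 hk.2 hA T0 (hA2 k hk.1 hk.2)
      exact ⟨G, hG, by omega, fun _ _ => h⟩
    · exact ⟨{0}, by simpa using Nat.one_le_two_pow, by simp, fun h1 h2 => absurd ⟨h1, h2⟩ hk⟩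
  choose G hGcard hG0 hG using hcover
  let S : Finset (PiLp q (fun _ : Fin m => Y)) :=
    K.biUnion fun k => (Fintype.piFinset fun i => G (k i)).image (WithLp.toLp q)
  refine entropyNum_le_of_cover (by positivity) S ?_ fun x hx => ?_
  · have h1 : S.card ≤ ∑ k ∈ K, 2 ^ (∑ i, k i) := by
      refine Finset.card_biUnion_le.trans (Finset.sum_le_sum fun k _ => ?_)
      refine Finset.card_image_le.trans ?_
      rw [Fintype.card_piFinset, ← Finset.prod_pow_eq_pow_sum]
      exact Finset.prod_le_prod' fun i _ => hGcard (k i)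
    have h2 : (S.card : ℝ) ≤ ∑ k ∈ K, (2 : ℝ) ^ (∑ i, k i) := by exact_mod_cast h1
    have hz1 : (n : ℝ) / (64 * lam * m) ≤ 1 := by
      rw [div_le_one (by positivity)]
      nlinarith
    have h3 := (h2.trans (sum_two_pow_sum_le (by positivity) hz1)).trans
      (count_bound_le_two_pow hn hnm hlam)
    exact_mod_cast h3
  · have hsum : ∑ i, ‖x i‖ ^ p.toReal ≤ 1 := by
      rw [PiLp.norm_eq_sum hp0] at hx
      by_contra! hcon
      exact hx.not_gt (Real.one_lt_rpow hcon (by positivity))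
    have hle1 : ∀ i, ‖x i‖ ^ p.toReal ≤ 1 := fun i =>
      (Finset.single_le_sum (f := fun i => ‖x i‖ ^ p.toReal) (fun i _ => by positivity)
        (Finset.mem_univ i)).trans hsum
    let k : Fin m → ℕ := fun i =>
      if 64 * lam / n < ‖x i‖ ^ p.toReal then ⌈n * ‖x i‖ ^ p.toReal / 8⌉₊ else 0
    have hk0 : ∀ i, k i ≠ 0 → 64 * lam / n < ‖x i‖ ^ p.toReal := by
      intro i hi
      by_contra h
      exact hi (if_neg h)
    have hkpos : ∀ i, 64 * lam / n < ‖x i‖ ^ p.toReal →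
        k i = ⌈n * ‖x i‖ ^ p.toReal / 8⌉₊ ∧ 1 ≤ k i := by
      intro i hi
      have hki : k i = ⌈n * ‖x i‖ ^ p.toReal / 8⌉₊ := if_pos hi
      have : 0 < 64 * lam / n := by positivity
      have h' : 0 < ‖x i‖ ^ p.toReal := this.trans hi
      exact ⟨hki, hki ▸ Nat.one_le_ceil_iff.2 (by positivity)⟩
    have hkn : ∀ i, k i ≤ n := by
      intro i
      simp only [k]
      split_ifs
      · rw [Nat.ceil_le]
        nlinarith [hle1 i]
      · exact Nat.zero_le _
    have hsupp : ((Finset.univ.filter fun i => k i ≠ 0).card : ℝ) ≤ s := by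
      have h1 : ((Finset.univ.filter fun i => k i ≠ 0).card : ℝ) * (64 * lam / n) ≤ 1 := by
        rw [← nsmul_eq_mul, ← Finset.sum_const]
        refine (Finset.sum_le_sum fun i hi => (hk0 i (Finset.mem_filter.1 hi).2).le).trans ?_
        exact (Finset.sum_le_sum_of_subset_of_nonneg (Finset.subset_univ _)
          fun i _ _ => by positivity).trans hsum
      rw [hs, le_div_iff₀ (by positivity)]
      rwa [mul_div_assoc', div_le_one (by linarith)] at h1
    have hksum : ((∑ i, k i : ℕ) : ℝ) ≤ n / 8 + s := by
      have h1 : ∀ i, ((k i : ℕ) : ℝ) ≤ n / 8 * ‖x i‖ ^ p.toReal + if k i ≠ 0 then 1 else 0 := by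
        intro i
        by_cases hi : k i = 0
        · simp only [hi, Nat.cast_zero, ne_eq, not_true_eq_false, if_false, add_zero]
          positivity
        · have h2 := Nat.ceil_lt_add_one (show 0 ≤ n * ‖x i‖ ^ p.toReal / 8 by positivity)
          rw [← (hkpos i (hk0 i hi)).1] at h2
          rw [if_pos hi]
          linarith
      push_cast
      refine (Finset.sum_le_sum fun i _ => h1 i).trans ?_
      rw [Finset.sum_add_distrib, ← Finset.mul_sum, Finset.sum_boole]
      have : (n : ℝ) / 8 * ∑ i, ‖x i‖ ^ p.toReal ≤ n / 8 * 1 := by gcongr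
      linarith
    have hkK : k ∈ K := Finset.mem_filter.2
      ⟨Fintype.mem_piFinset.2 fun i => Finset.mem_range.2 (Nat.lt_succ_of_le (hkn i)),
        hsupp, hksum⟩
    have hcoord : ∀ i, ∃ y ∈ G (k i), ‖T0 (x i) - y‖ ≤
        64 * A * (‖x i‖ ^ p.toReal + (k i : ℝ) / n) ^ (1 / q.toReal) := by
      intro i
      by_cases hi : 64 * lam / n < ‖x i‖ ^ p.toReal
      · obtain ⟨hki, hki1⟩ := hkpos i hi
        obtain ⟨y, hy, hd⟩ := hG (k i) hki1 (hkn i) (x i) (by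
          have h1 : ‖x i‖ ^ p.toReal ≤ 8 * k i / n := by
            have := Nat.le_ceil (n * ‖x i‖ ^ p.toReal / 8)
            rw [← hki] at this
            rw [le_div_iff₀ (by linarith)]
            linarith
          calc ‖x i‖ = (‖x i‖ ^ p.toReal) ^ (1 / p.toReal) := by
                rw [← Real.rpow_mul (norm_nonneg _), mul_one_div_cancel hp0.ne', Real.rpow_one]
            _ ≤ _ := by gcongr)
        refine ⟨y, hy, hd.trans ?_⟩
        gcongr
        · norm_num
        · have : 0 ≤ ‖x i‖ ^ p.toReal := by positivity
          linarith
      · have hki : k i = 0 := if_neg hi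
        refine ⟨0, hG0 _ hki, ?_⟩
        rw [hki, sub_zero, Nat.cast_zero, zero_div, add_zero]
        refine (norm_apply_le_of_rpow_le hp0 hα0.le T0 (not_lt.1 hi)).trans ?_
        refine mul_le_mul_of_nonneg_right ?_ (by positivity)
        rw [mul_div_assoc, Real.mul_rpow (by norm_num) (by positivity)]
        have h64 : (64 : ℝ) ^ (1 / p.toReal - 1 / q.toReal) ≤ 64 :=
          (Real.rpow_le_rpow_of_exponent_le (by norm_num) hα1).trans_eq (Real.rpow_one 64)
        calc _ = (64 : ℝ) ^ (1 / p.toReal - 1 / q.toReal) *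
              (‖T0‖ * (lam / n) ^ (1 / p.toReal - 1 / q.toReal)) := by ring
          _ ≤ _ := by gcongr
    choose y hyG hy using hcoord
    refine ⟨WithLp.toLp q y, Finset.mem_biUnion.2 ⟨k, hkK, Finset.mem_image_of_mem _
      (Fintype.mem_piFinset.2 hyG)⟩, ?_⟩
    have hbound := norm_piLp_le_of_forall_le (T x - WithLp.toLp q y) (B := 64 * A) (s := 2)
      (a := fun i => ‖x i‖ ^ p.toReal + (k i : ℝ) / n) (by positivity) (fun i => by positivity)
      (by
        rw [Finset.sum_add_distrib, ← Finset.sum_div]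
        push_cast at hksum
        have h1 : s ≤ n / 64 := by
          rw [hs, div_le_div_iff₀ (by positivity) (by norm_num)]
          nlinarith
        have h2 : (∑ i, (k i : ℝ)) / n ≤ 1 := by
          rw [div_le_one (by linarith)]
          linarith
        linarith)
      (fun i => by simpa only [PiLp.sub_apply, hT] using hy i)
    refine hbound.trans ?_
    have hq1 : 1 / q.toReal ≤ 1 := by
      have : 1 / p.toReal ≤ 1 := div_le_one_of_le₀ hp1 (by linarith)
      linarith
    have h2 : (2 : ℝ) ^ (1 / q.toReal) ≤ 2 :=
      (Real.rpow_le_rpow_of_exponent_le one_le_two hq1).trans_eq (Real.rpow_one 2)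
    nlinarith

/-- Theorem 3.2: two-sided estimates for the entropy numbers of the diagonal operator
`T(m) = (T₀, …, T₀) : ℓ_p^m(X) → ℓ_q^m(Y)` in terms of
`A(n,m,T₀) = max(‖T₀‖ ((log₂(m/n) + 1)/n)^α, max_{1 ≤ k ≤ n} (k/n)^α e_k(T₀))`. -/
theorem entropy_diagonal_two_sided (p q : ℝ≥0∞) [Fact (1 ≤ p)] [Fact (1 ≤ q)] (hpq : p < q) :
    ∃ c₁ c₂ : ℝ, 0 < c₁ ∧ 0 < c₂ ∧
      ∀ (m n : ℕ) (hn : 2 ≤ n) (hnm : n ≤ m) (hm2 : m ≤ 2 ^ n),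
        ∀ (X Y : Type) [NormedAddCommGroup X] [NormedSpace ℝ X]
          [NormedAddCommGroup Y] [NormedSpace ℝ Y]
          (T0 : X →L[ℝ] Y)
          (T : PiLp p (fun _ : Fin m => X) →L[ℝ] PiLp q (fun _ : Fin m => Y)),
          (∀ x i, T x i = T0 (x i)) →
          let A : ℝ := max
            (‖T0‖ * ((Real.logb 2 ((m : ℝ) / n) + 1) / n) ^ (1 / p.toReal - 1 / q.toReal))
            ((Finset.Icc 1 n).sup' (Finset.nonempty_Icc.mpr (by omega))
              (fun k => ((k : ℝ) / n) ^ (1 / p.toReal - 1 / q.toReal) * entropyNum k T0))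
          c₁ * A ≤ entropyNum n T ∧ entropyNum n T ≤ c₂ * A := by
  obtain ⟨hα0, hα1⟩ := one_div_sub_one_div_mem_Ioc hpq
  refine ⟨1 / 20000, 128, by norm_num, by norm_num, ?_⟩
  intro m n hn hnm hm2 X Y _ _ _ _ T0 T hT A
  have hn0 : (0 : ℝ) < n := by exact_mod_cast (by omega : 0 < n)
  have hlam1 := one_le_logb_div_add_one (by omega : 1 ≤ n) hnm
  have hfirst := opNorm_mul_rpow_le_entropyNum hpq hn hnm hm2 T0 T hT
  refine ⟨?_, ?_⟩
  · suffices A ≤ 20000 * entropyNum n T by linarith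
    have hent := entropyNum_nonneg n T
    refine max_le (hfirst.trans (by linarith)) (Finset.sup'_le _ _ fun k hk => ?_)
    obtain ⟨hk1, hkn⟩ := Finset.mem_Icc.1 hk
    rcases le_or_gt 6 k with hk6 | hk6
    · exact (rpow_mul_entropyNum_le_entropyNum hpq hk6 hkn hnm T0 T hT).trans (by linarith)
    · have hk6' : (k : ℝ) ≤ 6 := by exact_mod_cast hk6.le
      set lam := Real.logb 2 ((m : ℝ) / n) + 1
      have h1 : (k : ℝ) / n / 6 ≤ lam / n := by
        rw [div_right_comm]
        gcongr
        linarith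
      have h2 := (div_rpow_le_rpow_div (x := (k : ℝ) / n) (c := 6) (by positivity) (by norm_num)
        hα1).trans (Real.rpow_le_rpow (by positivity) h1 hα0.le)
      have h3 := mul_le_mul_of_nonneg_left h2 (norm_nonneg T0)
      have h4 := mul_le_mul_of_nonneg_left (entropyNum_le_opNorm k T0)
        (show 0 ≤ ((k : ℝ) / n) ^ (1 / p.toReal - 1 / q.toReal) by positivity)
      linarith
  · rcases (norm_nonneg T0).eq_or_lt with h0 | h0
    · have hT0 : T0 = 0 := norm_eq_zero.1 h0.symm
      have hTz : T = 0 := by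
        ext x i
        simp [hT, hT0]
      have hA0 : 0 ≤ A := le_max_of_le_left (by positivity)
      have := entropyNum_le_opNorm n T
      rw [hTz, norm_zero] at this
      rw [hTz]
      linarith
    · refine entropyNum_diagonal_le hpq hn hnm T0 T hT
        (lt_max_of_lt_left (by positivity)) (le_max_left _ _) fun k hk1 hkn => ?_
      exact le_max_of_le_right (Finset.le_sup' (fun k : ℕ =>
        ((k : ℝ) / n) ^ (1 / p.toReal - 1 / q.toReal) * entropyNum k T0)
        (Finset.mem_Icc.2 ⟨hk1, hkn⟩))
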